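/- arXiv:1809.07370 — 2 statements merged into one kernel-verified Lean document; each statement's English description precedes it below -/
import Mathlib

section
/- Let $r \geq 1$ and let $U_\mathbb{R} = \{ u \in (\mathbb{R}_{>0})^r : u_1 \cdots u_r = 1 \}$ with Haar measure $d^\times u = \frac{du_1 \cdots du_{r-1}}{u_1 \cdots u_{r-1}}$ (parametrized by $u_1,\dots,u_{r-1}$, with $u_r = (u_1\cdots u_{r-1})^{-1}$). Then for any $x \in (\mathbb{C}^\times)^r$, integers $p_1,\dots,p_r$ with $p = \sum_j p_j$, and $s \in \mathbb{C}$ with $\mathrm{Re}(s) > 0$ large enough that all Gamma arguments have positive real part, $\int_{U_\mathbb{R}} \Vert u x \Vert^{-2s} \prod_j u_j^{-2p_j}\, d^\times u = \frac{2^{1-r}}{r\, \Gamma(s)} \prod_{j=1}^r \Gamma\!\left( \frac{p+s}{r} - p_j \right) |x_j|^{2(p_j - (p+s)/r)}$, where $\Vert ux \Vert^2 = \sum_j u_j^2 |x_j|^2$. -/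
open MeasureTheory

/-- The point of the norm-one torus `U_ℝ ⊂ (ℝ_{>0})^r` parametrized by its first `r-1`
coordinates `w`: the `j`-th coordinate is `w j` for `j < r - 1` and `(∏ w i)⁻¹` for the
last coordinate. -/
noncomputable def torusCoord (r : ℕ) (w : Fin (r - 1) → ℝ) (j : Fin r) : ℝ :=
  if h : (j : ℕ) < r - 1 then w ⟨j, h⟩ else (∏ i, w i)⁻¹

theorem integrable_and_integral_cexp_mul_sub_exp {a : ℂ} (ha : 0 < a.re) :
    Integrable (fun t : ℝ => Complex.exp (a * t - Real.exp t)) ∧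
      ∫ t : ℝ, Complex.exp (a * t - Real.exp t) = Complex.Gamma a := by
  have himg : Real.exp '' Set.univ = Set.Ioi 0 := by
    rw [Set.image_univ, Real.range_exp]
  have hd : ∀ t ∈ (Set.univ : Set ℝ), HasDerivWithinAt Real.exp (Real.exp t) Set.univ t :=
    fun t _ => (Real.hasDerivAt_exp t).hasDerivWithinAt
  have hinj : Set.InjOn Real.exp Set.univ := Real.exp_injective.injOn
  have hfun : ∀ t : ℝ, |Real.exp t| •
      (((Real.exp (-Real.exp t) : ℝ) : ℂ) * ((Real.exp t : ℝ) : ℂ) ^ (a - 1)) =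
        Complex.exp (a * t - Real.exp t) := by
    intro t
    have h0 : ((Real.exp t : ℝ) : ℂ) ≠ 0 := by exact_mod_cast (Real.exp_pos t).ne'
    rw [abs_of_pos (Real.exp_pos t), Complex.real_smul, Complex.cpow_def_of_ne_zero h0,
      ← Complex.ofReal_log (Real.exp_pos t).le, Real.log_exp]
    push_cast
    rw [← Complex.exp_add, ← Complex.exp_add]
    congr 1
    ring
  constructor
  · have h := (integrableOn_image_iff_integrableOn_abs_deriv_smul MeasurableSet.univ hd hinj
      (fun x : ℝ => ((Real.exp (-x) : ℝ) : ℂ) * (x : ℂ) ^ (a - 1))).1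
        (by rw [himg]; exact Complex.GammaIntegral_convergent ha)
    rw [integrableOn_univ] at h
    exact h.congr (Filter.Eventually.of_forall hfun)
  · have h := integral_image_eq_integral_abs_deriv_smul MeasurableSet.univ hd hinj
      (fun x : ℝ => ((Real.exp (-x) : ℝ) : ℂ) * (x : ℂ) ^ (a - 1))
    rw [himg, setIntegral_univ] at h
    rw [Complex.Gamma_eq_integral ha, Complex.GammaIntegral, h]
    exact integral_congr_ae (Filter.Eventually.of_forall fun t => (hfun t).symm)

theorem integrable_and_integral_cexp_mul_sub_mul_exp {a : ℂ} (ha : 0 < a.re) {c : ℝ}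
    (hc : 0 < c) :
    Integrable (fun t : ℝ => Complex.exp (a * t - c * Real.exp t)) ∧
      ∫ t : ℝ, Complex.exp (a * t - c * Real.exp t) = (c : ℂ) ^ (-a) * Complex.Gamma a := by
  have hc' : (c : ℂ) ≠ 0 := by exact_mod_cast hc.ne'
  have hfun : (fun t : ℝ => Complex.exp (a * t - c * Real.exp t)) = fun t : ℝ =>
      (c : ℂ) ^ (-a) *
        Complex.exp (a * ((t + Real.log c : ℝ) : ℂ) - Real.exp (t + Real.log c)) := by
    funext t
    rw [Complex.cpow_def_of_ne_zero hc', ← Complex.exp_add, ← Complex.ofReal_log hc.le,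
      Real.exp_add, Real.exp_log hc]
    congr 1
    push_cast
    ring
  obtain ⟨h1, h2⟩ := integrable_and_integral_cexp_mul_sub_exp ha
  rw [hfun]
  refine ⟨(h1.comp_add_right (Real.log c)).const_mul _, ?_⟩
  rw [integral_const_mul, ← h2]
  congr 1
  exact integral_add_right_eq_self
    (fun t : ℝ => Complex.exp (a * t - Real.exp t)) (Real.log c)

/-- Logarithmic coordinates on the norm-one torus. -/
def logTorusCoord {n : ℕ} (v : Fin n → ℝ) : Fin (n + 1) → ℝ :=
  Fin.snoc (α := fun _ => ℝ) v (-∑ i, v i)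

theorem sum_logTorusCoord {n : ℕ} (v : Fin n → ℝ) : ∑ j, logTorusCoord v j = 0 := by
  simp [logTorusCoord, Fin.sum_univ_castSucc]

theorem torusCoord_exp {n : ℕ} (v : Fin n → ℝ) (j : Fin (n + 1)) :
    torusCoord (n + 1) (fun i => Real.exp (v i)) j = Real.exp (logTorusCoord v j) := by
  refine Fin.lastCases ?_ (fun i => ?_) j
  · have h : ¬ ((Fin.last n : Fin (n + 1)) : ℕ) < n + 1 - 1 := by simp
    rw [torusCoord, dif_neg h, logTorusCoord, Fin.snoc_last, Real.exp_neg, Real.exp_sum]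
    rfl
  · have h : ((Fin.castSucc i : Fin (n + 1)) : ℕ) < n + 1 - 1 := by simp
    rw [torusCoord, dif_pos h, logTorusCoord, Fin.snoc_castSucc]
    rfl

/-- The matrix expressing `log (t * u j ^ 2)` through the logarithmic coordinates of `u` and
`log t`. -/
def coneMatrix (n : ℕ) : Matrix (Fin (n + 1)) (Fin (n + 1)) ℝ :=
  Matrix.reindex finSumFinEquiv finSumFinEquiv
    (Matrix.fromBlocks ((2 : ℝ) • (1 : Matrix (Fin n) (Fin n) ℝ)) (Matrix.of fun _ _ => 1)
      (Matrix.of fun _ _ => -2) (1 : Matrix (Fin 1) (Fin 1) ℝ))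

theorem det_coneMatrix (n : ℕ) : (coneMatrix n).det = 2 ^ n * (n + 1) := by
  rw [coneMatrix, Matrix.det_reindex_self, Matrix.det_fromBlocks_one₂₂]
  have : (2 : ℝ) • (1 : Matrix (Fin n) (Fin n) ℝ) -
      (Matrix.of fun _ _ => 1 : Matrix (Fin n) (Fin 1) ℝ) *
        (Matrix.of fun _ _ => -2 : Matrix (Fin 1) (Fin n) ℝ) =
      (2 : ℝ) • (1 + Matrix.replicateCol (Fin 1) (fun _ => (1 : ℝ)) *
        Matrix.replicateRow (Fin 1) (fun _ => (1 : ℝ))) := by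
    ext i j
    simp [Matrix.mul_apply]
    ring
  rw [this, Matrix.det_smul, Matrix.det_one_add_mul_comm, Matrix.det_fin_one]
  simp [Matrix.mul_apply, add_comm]

theorem coneMatrix_mulVec_snoc {n : ℕ} (v : Fin n → ℝ) (t : ℝ) (j : Fin (n + 1)) :
    (coneMatrix n).mulVec (Fin.snoc (α := fun _ => ℝ) v t) j = t + 2 * logTorusCoord v j := by
  have hs : ∀ i : Fin n, finSumFinEquiv.symm (Fin.castSucc i : Fin (n + 1)) = Sum.inl i :=
    fun i => finSumFinEquiv_symm_apply_castAdd (n := 1) i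
  have hl : finSumFinEquiv.symm (Fin.last n) = Sum.inr (0 : Fin 1) :=
    finSumFinEquiv_symm_last
  refine Fin.lastCases ?_ (fun i => ?_) j
  · simp [Matrix.mulVec, dotProduct, Fin.sum_univ_castSucc, coneMatrix, logTorusCoord, hs, hl,
      ← Finset.mul_sum]
    ring
  · simp [Matrix.mulVec, dotProduct, Fin.sum_univ_castSucc, coneMatrix, logTorusCoord, hs, hl,
      Matrix.one_apply]
    ring

theorem integrable_and_integral_comp_cone {n : ℕ} {g : (Fin (n + 1) → ℝ) → ℂ}
    (hg : Integrable g) :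
    Integrable (fun q : ℝ × (Fin n → ℝ) => g fun j => q.1 + 2 * logTorusCoord q.2 j) ∧
      ∫ q : ℝ × (Fin n → ℝ), g (fun j => q.1 + 2 * logTorusCoord q.2 j) =
        ((2 : ℂ) ^ n * (n + 1))⁻¹ * ∫ y, g y := by
  have hpos : (0 : ℝ) < 2 ^ n * (n + 1) := by positivity
  have hmap := Real.map_matrix_volume_pi_eq_smul_volume_pi (M := coneMatrix n)
    (by rw [det_coneMatrix]; exact hpos.ne')
  have hmeas : AEMeasurable (Matrix.toLin' (coneMatrix n)) volume :=
    (LinearMap.continuous_of_finiteDimensional _).aemeasurable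
  have hg' : Integrable g (Measure.map (Matrix.toLin' (coneMatrix n)) volume) := by
    rw [hmap]
    exact hg.smul_measure ENNReal.ofReal_ne_top
  have hint : Integrable (fun z => g (Matrix.toLin' (coneMatrix n) z)) :=
    (integrable_map_measure hg'.1 hmeas).1 hg'
  have hval : ∫ z, g (Matrix.toLin' (coneMatrix n) z) =
      ((2 : ℂ) ^ n * (n + 1))⁻¹ * ∫ y, g y := by
    rw [← integral_map hmeas hg'.1, hmap, integral_smul_measure, det_coneMatrix,
      abs_of_pos (inv_pos.2 hpos), ENNReal.toReal_ofReal (inv_pos.2 hpos).le, Complex.real_smul]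
    push_cast
    rfl
  have hmp := (volume_preserving_piFinSuccAbove (fun _ : Fin (n + 1) => ℝ) (Fin.last n)).symm
  have hfun : (fun q : ℝ × (Fin n → ℝ) => g fun j => q.1 + 2 * logTorusCoord q.2 j) =
      fun q => g (Matrix.toLin' (coneMatrix n)
        ((MeasurableEquiv.piFinSuccAbove (fun _ : Fin (n + 1) => ℝ) (Fin.last n)).symm q)) := by
    funext q
    congr 1
    funext j
    rw [Matrix.toLin'_apply, ← coneMatrix_mulVec_snoc]
    congr 1
    exact (Fin.insertNth_last' q.1 q.2).symm
  rw [hfun]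
  exact ⟨hmp.integrable_comp_of_integrable hint, (hmp.integral_comp' _).trans hval⟩

theorem integral_logTorusCoord {n : ℕ} {a : Fin (n + 1) → ℂ} (ha : ∀ j, 0 < (a j).re)
    {c : Fin (n + 1) → ℝ} (hc : ∀ j, 0 < c j) :
    ∫ v : Fin n → ℝ, ((∑ j, Real.exp (logTorusCoord v j) ^ 2 * c j : ℝ) : ℂ) ^ (-∑ j, a j) *
        Complex.exp (2 * ∑ j, a j * logTorusCoord v j) =
      ((2 : ℂ) ^ n * (n + 1) * Complex.Gamma (∑ j, a j))⁻¹ *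
        ∏ j, ((c j : ℂ) ^ (-a j) * Complex.Gamma (a j)) := by
  have hre : 0 < (∑ j, a j).re := by
    rw [Complex.re_sum]
    exact Finset.sum_pos (fun j _ => ha j) Finset.univ_nonempty
  have hg : Integrable fun y : Fin (n + 1) → ℝ =>
      ∏ j, Complex.exp (a j * y j - c j * Real.exp (y j)) :=
    Integrable.fintype_prod_dep (f := fun j (t : ℝ) => Complex.exp (a j * t - c j * Real.exp t))
      fun j => (integrable_and_integral_cexp_mul_sub_mul_exp (ha j) (hc j)).1
  have hval : ∫ y : Fin (n + 1) → ℝ, ∏ j, Complex.exp (a j * y j - c j * Real.exp (y j)) =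
      ∏ j, ((c j : ℂ) ^ (-a j) * Complex.Gamma (a j)) := by
    rw [integral_fintype_prod_volume_eq_prod
      (fun j (t : ℝ) => Complex.exp (a j * t - c j * Real.exp t))]
    exact Finset.prod_congr rfl fun j _ =>
      (integrable_and_integral_cexp_mul_sub_mul_exp (ha j) (hc j)).2
  obtain ⟨hi, he⟩ := integrable_and_integral_comp_cone hg
  have hfib : ∀ (v : Fin n → ℝ) (t : ℝ),
      ∏ j, Complex.exp (a j * ((t + 2 * logTorusCoord v j : ℝ) : ℂ) -
          c j * Real.exp (t + 2 * logTorusCoord v j)) =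
        Complex.exp (2 * ∑ j, a j * logTorusCoord v j) *
          Complex.exp ((∑ j, a j) * t -
            (∑ j, Real.exp (logTorusCoord v j) ^ 2 * c j : ℝ) * Real.exp t) := by
    intro v t
    rw [← Complex.exp_sum, ← Complex.exp_add]
    congr 1
    push_cast
    rw [Finset.mul_sum, Finset.sum_mul, Finset.sum_mul, ← Finset.sum_sub_distrib,
      ← Finset.sum_add_distrib]
    refine Finset.sum_congr rfl fun j _ => ?_
    rw [Complex.exp_add, two_mul (logTorusCoord v j : ℂ), Complex.exp_add]
    ring
  have hinner : ∀ v : Fin n → ℝ,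
      ∫ t : ℝ, ∏ j, Complex.exp (a j * ((t + 2 * logTorusCoord v j : ℝ) : ℂ) -
          c j * Real.exp (t + 2 * logTorusCoord v j)) =
        ((∑ j, Real.exp (logTorusCoord v j) ^ 2 * c j : ℝ) : ℂ) ^ (-∑ j, a j) *
          Complex.exp (2 * ∑ j, a j * logTorusCoord v j) * Complex.Gamma (∑ j, a j) := by
    intro v
    have hA : 0 < ∑ j, Real.exp (logTorusCoord v j) ^ 2 * c j :=
      Finset.sum_pos (fun j _ => mul_pos (pow_pos (Real.exp_pos _) 2) (hc j))
        Finset.univ_nonempty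
    simp_rw [hfib v]
    rw [integral_const_mul, (integrable_and_integral_cexp_mul_sub_mul_exp hre hA).2]
    ring
  rw [Measure.volume_eq_prod] at hi he
  rw [integral_prod_symm _ hi] at he
  simp_rw [hinner] at he
  rw [integral_mul_const, hval] at he
  have hΓ := Complex.Gamma_ne_zero_of_re_pos hre
  rw [mul_inv, mul_right_comm, ← he, mul_assoc, mul_inv_cancel₀ hΓ, mul_one]

theorem setIntegral_pos_pi_eq_integral_exp {n : ℕ} (f : (Fin n → ℝ) → ℂ) :
    ∫ w in {w : Fin n → ℝ | ∀ i, 0 < w i}, f w * ((∏ i, (w i)⁻¹ : ℝ) : ℂ) =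
      ∫ v : Fin n → ℝ, f fun i => Real.exp (v i) := by
  have himg : (fun (v : Fin n → ℝ) i => Real.exp (v i)) '' Set.univ =
      {w : Fin n → ℝ | ∀ i, 0 < w i} := by
    ext w
    constructor
    · rintro ⟨v, -, rfl⟩ i
      exact Real.exp_pos _
    · intro hw
      exact ⟨fun i => Real.log (w i), trivial, funext fun i => Real.exp_log (hw i)⟩
  have hd : ∀ v ∈ (Set.univ : Set (Fin n → ℝ)),
      HasFDerivWithinAt (fun (v : Fin n → ℝ) i => Real.exp (v i))
        (ContinuousLinearMap.pi fun i =>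
          ((ContinuousLinearMap.toSpanSingleton ℝ (Real.exp (v i))).comp
            (ContinuousLinearMap.proj i))) Set.univ v := by
    intro v _
    rw [hasFDerivWithinAt_univ, hasFDerivAt_pi]
    intro i
    exact HasFDerivAt.comp (g := Real.exp) (f := fun v : Fin n → ℝ => v i) v
      (Real.hasDerivAt_exp (v i)).hasFDerivAt (hasFDerivAt_apply i v)
  have hinj : Set.InjOn (fun (v : Fin n → ℝ) i => Real.exp (v i)) Set.univ :=
    fun v _ w _ h => funext fun i => Real.exp_injective (congrFun h i)
  rw [← himg, integral_image_eq_integral_abs_det_fderiv_smul volume MeasurableSet.univ hd hinj,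
    setIntegral_univ]
  refine integral_congr_ae (Filter.Eventually.of_forall fun v => ?_)
  have hpos : 0 < ∏ i, Real.exp (v i) := Finset.prod_pos fun i _ => Real.exp_pos _
  have hne : ((∏ i, Real.exp (v i) : ℝ) : ℂ) ≠ 0 := by exact_mod_cast hpos.ne'
  simp only [ContinuousLinearMap.det_pi, ContinuousLinearMap.det_toSpanSingleton]
  rw [abs_of_pos hpos, Complex.real_smul, Finset.prod_inv_distrib, Complex.ofReal_inv]
  field_simp
/-- **The Hecke transform** (Definition-Proposition 3.3): for `x ∈ (ℂ^×)^r`,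
integers `p₁, …, p_r` with `p = ∑ pⱼ`, and `s ∈ ℂ` with all Gamma arguments of
positive real part,
`∫_{U_ℝ} ‖ux‖^{-2s} ∏ⱼ uⱼ^{-2pⱼ} d^×u
  = 2^{1-r}/(r Γ(s)) ∏ⱼ Γ((p+s)/r - pⱼ) |xⱼ|^{2(pⱼ - (p+s)/r)}`,
where `‖ux‖² = ∑ⱼ uⱼ² |xⱼ|²` and `d^×u = du₁⋯du_{r-1}/(u₁⋯u_{r-1})`. -/
theorem hecke_transform (r : ℕ) (hr : 1 ≤ r) (x : Fin r → ℂ) (hx : ∀ j, x j ≠ 0)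
    (p : Fin r → ℤ) (s : ℂ) (hs : 0 < s.re)
    (hpos : ∀ j, 0 < ((((∑ i, (p i : ℂ)) + s) / (r : ℂ)) - (p j : ℂ)).re) :
    (∫ w in {w : Fin (r - 1) → ℝ | ∀ i, 0 < w i},
        ((((∑ j, (torusCoord r w j) ^ 2 * ‖x j‖ ^ 2 : ℝ)) : ℂ) ^ (-s) *
          ∏ j, ((torusCoord r w j : ℂ) ^ (-2 * p j))) * ((∏ i, (w i)⁻¹ : ℝ) : ℂ)) =
      (2 : ℂ) ^ ((1 : ℤ) - (r : ℤ)) / ((r : ℂ) * Complex.Gamma s) *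
        ∏ j, Complex.Gamma ((((∑ i, (p i : ℂ)) + s) / (r : ℂ)) - (p j : ℂ)) *
          ((‖x j‖ : ℂ) ^ (2 * ((p j : ℂ) - (((∑ i, (p i : ℂ)) + s) / (r : ℂ))))) := by
  obtain ⟨n, rfl⟩ := Nat.exists_eq_add_of_le' hr
  set a : Fin (n + 1) → ℂ :=
    fun j => ((∑ i, (p i : ℂ)) + s) / ((n + 1 : ℕ) : ℂ) - (p j : ℂ) with ha
  have hn : ((n + 1 : ℕ) : ℂ) ≠ 0 := by exact_mod_cast n.succ_ne_zero
  have hsum : ∑ j, a j = s := by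
    simp only [ha, Finset.sum_sub_distrib, Finset.sum_const, Finset.card_univ, Fintype.card_fin,
      nsmul_eq_mul]
    rw [mul_div_cancel₀ _ hn]
    ring
  have hmain := integral_logTorusCoord (a := a) hpos (c := fun j => ‖x j‖ ^ 2)
    fun j => pow_pos (norm_pos_iff.2 (hx j)) 2
  rw [hsum] at hmain
  refine (setIntegral_pos_pi_eq_integral_exp (n := n) _).trans ?_
  have hchar : ∀ v : Fin n → ℝ,
      ∏ j, (((Real.exp (logTorusCoord v j) : ℝ) : ℂ) ^ (-2 * p j)) =
        Complex.exp (2 * ∑ j, a j * logTorusCoord v j) := by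
    intro v
    have h0 : ∑ j, (logTorusCoord v j : ℂ) = 0 := by exact_mod_cast sum_logTorusCoord v
    simp only [ha, sub_mul, Finset.sum_sub_distrib, ← Finset.mul_sum, h0, mul_zero, zero_sub]
    rw [← Finset.sum_neg_distrib, Finset.mul_sum, Complex.exp_sum]
    refine Finset.prod_congr rfl fun j _ => ?_
    rw [Complex.ofReal_exp, ← Complex.exp_int_mul]
    congr 1
    push_cast
    ring
  have hint : ∀ v : Fin n → ℝ,
      ((∑ j, torusCoord (n + 1) (fun i => Real.exp (v i)) j ^ 2 * ‖x j‖ ^ 2 : ℝ) : ℂ) ^ (-s) *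
          ∏ j, ((torusCoord (n + 1) (fun i => Real.exp (v i)) j : ℂ) ^ (-2 * p j)) =
        ((∑ j, Real.exp (logTorusCoord v j) ^ 2 * ‖x j‖ ^ 2 : ℝ) : ℂ) ^ (-s) *
          Complex.exp (2 * ∑ j, a j * logTorusCoord v j) := by
    intro v
    rw [← hchar v, funext (torusCoord_exp v)]
  refine ((integral_congr_ae (Filter.Eventually.of_forall hint)).trans hmain).trans ?_
  have hnorm : ∀ j, (((‖x j‖ ^ 2 : ℝ)) : ℂ) ^ (-a j) * Complex.Gamma (a j) =
      Complex.Gamma (a j) * (‖x j‖ : ℂ) ^ (2 * ((p j : ℂ) -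
        (((∑ i, (p i : ℂ)) + s) / ((n + 1 : ℕ) : ℂ)))) := by
    intro j
    have hxj := norm_pos_iff.2 (hx j)
    have h1 : (((‖x j‖ ^ 2 : ℝ)) : ℂ) ≠ 0 := by exact_mod_cast (pow_pos hxj 2).ne'
    have h2 : (‖x j‖ : ℂ) ≠ 0 := by exact_mod_cast hxj.ne'
    rw [mul_comm, Complex.cpow_def_of_ne_zero h1, Complex.cpow_def_of_ne_zero h2,
      ← Complex.ofReal_log (pow_pos hxj 2).le, ← Complex.ofReal_log hxj.le, Real.log_pow]
    congr 2
    simp only [ha]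
    push_cast
    ring
  simp_rw [hnorm]
  congr 1
  have h2 : (1 : ℤ) - ((n + 1 : ℕ) : ℤ) = -(n : ℤ) := by push_cast; ring
  rw [h2, zpow_neg, zpow_natCast, mul_assoc, mul_inv, div_eq_mul_inv]
  push_cast
  rfl
end

section
/- Let $U_\mathbb{R} = \{(u_1,\dots,u_r) \in (\mathbb{R}_{>0})^r : u_1\cdots u_r = 1\}$ and let $n = (n_1,\dots,n_r) \in (\mathbb{R}^\times)^r$. Then for $\delta > 0$, $\int_{U_\mathbb{R}} \Vert u n \Vert^{-(r+\delta)}\, d^\times u = \frac{2^{1-r} \Gamma\left(\frac{r+\delta}{2r}\right)^r}{r\, \Gamma\left(\frac{r+\delta}{2}\right)} \cdot \frac{1}{\prod_{j=1}^r |n_j|^{(r+\delta)/r}}$, where $\Vert un \Vert^2 = \sum_j u_j^2 n_j^2$ and $d^\times u = \frac{du_1\cdots du_{r-1}}{u_1 \cdots u_{r-1}}$. -/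
open MeasureTheory

theorem measurableSet_positive_orthant {ι : Type*} [Fintype ι] :
    MeasurableSet {w : ι → ℝ | ∀ i, 0 < w i} := by
  simp only [Set.ofPred_forall]
  exact MeasurableSet.iInter fun i => measurableSet_lt measurable_const (measurable_pi_apply i)

/-- The dilation change of variables on the open positive orthant. -/
theorem setLIntegral_positive_orthant_comp_smul {ι : Type*} [Fintype ι] {f : (ι → ℝ) → ENNReal}
    (hf : Measurable f) {s : ℝ} (hs : 0 < s) :
    ∫⁻ w in {w : ι → ℝ | ∀ i, 0 < w i}, f (s • w) =
      ENNReal.ofReal (s ^ Fintype.card ι)⁻¹ * ∫⁻ w in {w : ι → ℝ | ∀ i, 0 < w i}, f w := by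
  have hP : MeasurableSet {w : ι → ℝ | ∀ i, 0 < w i} :=
    measurableSet_positive_orthant
  have hpre : (fun w : ι → ℝ => s • w) ⁻¹' {w | ∀ i, 0 < w i} = {w | ∀ i, 0 < w i} := by
    ext w
    simp [hs]
  have h := setLIntegral_map (μ := (volume : Measure (ι → ℝ))) hP hf
    (measurable_const_smul s)
  rw [hpre, Measure.map_addHaar_smul volume hs.ne', Measure.restrict_smul,
    lintegral_smul_measure, Module.finrank_fintype_fun_eq_card, abs_of_pos (by positivity)] at h
  exact h.symm

theorem lintegral_rpow_mul_exp_neg_mul_rpow {p a b : ℝ} (hp : 0 < p) (ha : 0 < a) (hb : 0 < b) :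
    ∫⁻ x in Set.Ioi (0 : ℝ), ENNReal.ofReal (x ^ (a - 1) * Real.exp (-b * x ^ p)) =
      ENNReal.ofReal (b ^ (-a / p) * (1 / p) * Real.Gamma (a / p)) := by
  rw [← ofReal_integral_eq_lintegral_ofReal
    (integrableOn_rpow_mul_exp_neg_mul_rpow (by linarith) hp hb),
    integral_rpow_mul_exp_neg_mul_rpow hp (by linarith) hb, sub_add_cancel]
  filter_upwards [ae_restrict_mem measurableSet_Ioi] with x hx
  exact mul_nonneg (Real.rpow_nonneg (le_of_lt hx) _) (Real.exp_pos _).le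

/-- Passing from the coordinates `(s, w)` to `(s, s • w)` separates the variables of the
Gaussian on the torus. -/
theorem lintegral_torus_gaussian_eq {ι : Type*} [Fintype ι] (c : ι → ℝ) (d a : ℝ) :
    ∫⁻ w in {w : ι → ℝ | ∀ i, 0 < w i}, ∫⁻ s in Set.Ioi (0 : ℝ),
        ENNReal.ofReal ((∏ i, (w i)⁻¹) *
          (s ^ (a - 1) * Real.exp (-(∑ i, w i ^ 2 * c i + (∏ i, w i)⁻¹ ^ 2 * d) * s ^ (2 : ℝ)))) =
      ∫⁻ w in {w : ι → ℝ | ∀ i, 0 < w i}, ∫⁻ s in Set.Ioi (0 : ℝ),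
        ENNReal.ofReal ((∏ i, (w i)⁻¹) * Real.exp (-∑ i, w i ^ 2 * c i) *
          (s ^ (a - 1) * Real.exp (-((∏ i, w i)⁻¹ ^ 2 * d) *
            s ^ (2 * ((Fintype.card ι : ℝ) + 1))))) := by
  refine (lintegral_lintegral_swap (by fun_prop)).trans
    (Eq.trans ?_ (lintegral_lintegral_swap (by fun_prop)).symm)
  refine setLIntegral_congr_fun measurableSet_Ioi fun s hs => ?_
  have hs : 0 < s := hs
  have hm : Measurable fun w : ι → ℝ => ENNReal.ofReal
      ((∏ i, (w i)⁻¹) * Real.exp (-∑ i, w i ^ 2 * c i) *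
          (s ^ (a - 1) * Real.exp (-((∏ i, w i)⁻¹ ^ 2 * d) *
            s ^ (2 * ((Fintype.card ι : ℝ) + 1))))) := by fun_prop
  have key := setLIntegral_positive_orthant_comp_smul hm hs
  have hsm : 0 < s ^ Fintype.card ι := by positivity
  have hne : ENNReal.ofReal (s ^ Fintype.card ι)⁻¹ ≠ 0 := by
    rw [Ne, ENNReal.ofReal_eq_zero, not_le]
    positivity
  rw [← ENNReal.mul_right_inj hne ENNReal.ofReal_ne_top, ← key,
    ← lintegral_const_mul' _ _ ENNReal.ofReal_ne_top]
  refine lintegral_congr fun w => ?_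
  rw [← ENNReal.ofReal_mul (by positivity)]
  congr 1
  have hpow : s ^ (2 * ((Fintype.card ι : ℝ) + 1)) = (s ^ Fintype.card ι) ^ 2 * s ^ 2 := by
    rw [show 2 * ((Fintype.card ι : ℝ) + 1) = ((Fintype.card ι * 2 + 2 : ℕ) : ℝ) by
      push_cast; ring, Real.rpow_natCast, pow_add, pow_mul]
  simp only [Pi.smul_apply, smul_eq_mul, mul_inv, Finset.prod_mul_distrib, Finset.prod_const,
    Finset.card_univ, mul_pow, mul_assoc, ← Finset.mul_sum, hpow, Real.rpow_two]
  rw [mul_left_comm (Real.exp _), ← Real.exp_add, inv_pow s]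
  congr 4
  have hcancel : (s ^ Fintype.card ι)⁻¹ ^ 2 * (s ^ Fintype.card ι) ^ 2 = 1 := by
    rw [← mul_pow, inv_mul_cancel₀ hsm.ne', one_pow]
  linear_combination ((∏ i, w i)⁻¹ ^ 2 * d * s ^ 2) * hcancel

theorem integral_torus_rpow {ι : Type*} [Fintype ι] {c : ι → ℝ} (hc : ∀ i, 0 < c i) {d a : ℝ}
    (hd : 0 < d) (ha : 0 < a) :
    ∫ w in {w : ι → ℝ | ∀ i, 0 < w i},
        (∑ i, w i ^ 2 * c i + (∏ i, w i)⁻¹ ^ 2 * d) ^ (-a / 2) * ∏ i, (w i)⁻¹ =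
      Real.Gamma (a / (2 * ((Fintype.card ι : ℝ) + 1))) ^ (Fintype.card ι + 1) /
        (2 ^ Fintype.card ι * ((Fintype.card ι : ℝ) + 1) * Real.Gamma (a / 2)) *
        ((∏ i, c i ^ (-a / (2 * ((Fintype.card ι : ℝ) + 1)))) *
          d ^ (-a / (2 * ((Fintype.card ι : ℝ) + 1)))) := by
  set p : ℝ := 2 * ((Fintype.card ι : ℝ) + 1) with hp_def
  have hp : 0 < p := by positivity
  have hP : MeasurableSet {w : ι → ℝ | ∀ i, 0 < w i} :=
    measurableSet_positive_orthant
  have hΓ : 0 < Real.Gamma (a / 2) := Real.Gamma_pos_of_pos (by positivity)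
  have hQ : ∀ w : ι → ℝ, (∀ i, 0 < w i) →
      0 < ∑ i, w i ^ 2 * c i + (∏ i, w i)⁻¹ ^ 2 * d := by
    intro w hw
    have h1 : 0 < ∏ i, w i := Finset.prod_pos fun i _ => hw i
    have h2 : 0 ≤ ∑ i, w i ^ 2 * c i :=
      Finset.sum_nonneg fun i _ => mul_nonneg (sq_nonneg _) (hc i).le
    positivity
  have hleft : ∫ w in {w : ι → ℝ | ∀ i, 0 < w i},
      ((∑ i, w i ^ 2 * c i + (∏ i, w i)⁻¹ ^ 2 * d) ^ (-a / 2) * ∏ i, (w i)⁻¹) *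
        (1 / 2 * Real.Gamma (a / 2)) =
      (∫⁻ w in {w : ι → ℝ | ∀ i, 0 < w i}, ∫⁻ s in Set.Ioi (0 : ℝ),
        ENNReal.ofReal ((∏ i, (w i)⁻¹) *
          (s ^ (a - 1) * Real.exp
            (-(∑ i, w i ^ 2 * c i + (∏ i, w i)⁻¹ ^ 2 * d) * s ^ (2 : ℝ))))).toReal := by
    rw [integral_eq_lintegral_of_nonneg_ae]
    · congr 1
      refine setLIntegral_congr_fun hP fun w hw => ?_
      have h1 : 0 ≤ ∏ i, (w i)⁻¹ := Finset.prod_nonneg fun i _ => (inv_pos.2 (hw i)).le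
      simp only [ENNReal.ofReal_mul h1]
      rw [lintegral_const_mul' _ _ ENNReal.ofReal_ne_top,
        lintegral_rpow_mul_exp_neg_mul_rpow two_pos ha (hQ w hw), ← ENNReal.ofReal_mul h1]
      congr 1
      ring
    · filter_upwards [ae_restrict_mem hP] with w hw
      have h1 : 0 ≤ ∏ i, (w i)⁻¹ := Finset.prod_nonneg fun i _ => (inv_pos.2 (hw i)).le
      have h2 := Real.rpow_nonneg (hQ w hw).le (-a / 2)
      simp only [Pi.zero_apply]
      positivity
    · exact Measurable.aestronglyMeasurable (by fun_prop)
  have hright : (∫⁻ w in {w : ι → ℝ | ∀ i, 0 < w i}, ∫⁻ s in Set.Ioi (0 : ℝ),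
        ENNReal.ofReal ((∏ i, (w i)⁻¹) * Real.exp (-∑ i, w i ^ 2 * c i) *
          (s ^ (a - 1) * Real.exp (-((∏ i, w i)⁻¹ ^ 2 * d) * s ^ p)))).toReal =
      ∫ w in {w : ι → ℝ | ∀ i, 0 < w i},
        (∏ i, w i ^ (2 * a / p - 1) * Real.exp (-c i * w i ^ (2 : ℝ))) *
          (d ^ (-a / p) * (1 / p) * Real.Gamma (a / p)) := by
    rw [integral_eq_lintegral_of_nonneg_ae]
    · congr 1
      refine setLIntegral_congr_fun hP fun w hw => ?_
      have hw : ∀ i, 0 < w i := hw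
      have h0 : 0 < ∏ i, w i := Finset.prod_pos fun i _ => hw i
      have h1 : 0 ≤ (∏ i, (w i)⁻¹) * Real.exp (-∑ i, w i ^ 2 * c i) :=
        mul_nonneg (Finset.prod_nonneg fun i _ => (inv_pos.2 (hw i)).le) (Real.exp_pos _).le
      simp only [ENNReal.ofReal_mul h1]
      rw [lintegral_const_mul' _ _ ENNReal.ofReal_ne_top,
        lintegral_rpow_mul_exp_neg_mul_rpow hp ha (by positivity), ← ENNReal.ofReal_mul h1]
      congr 1
      have h2 : ((∏ i, w i)⁻¹ ^ 2) ^ (-a / p) = ∏ i, w i ^ (2 * a / p) := by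
        rw [Real.finsetProd_rpow _ _ fun i _ => (hw i).le, ← Real.rpow_two,
          ← Real.rpow_mul (by positivity), Real.inv_rpow h0.le, ← Real.rpow_neg h0.le]
        congr 1
        ring
      rw [Real.mul_rpow (by positivity) hd.le, h2, Finset.prod_mul_distrib, ← Real.exp_sum]
      simp only [Real.rpow_sub_one (hw _).ne', div_eq_mul_inv (_ ^ _), Finset.prod_mul_distrib,
        Real.rpow_two, neg_mul, Finset.sum_neg_distrib, mul_comm (c _)]
      ring
    · filter_upwards [ae_restrict_mem hP] with w hw
      have h1 : 0 ≤ ∏ i, w i ^ (2 * a / p - 1) * Real.exp (-c i * w i ^ (2 : ℝ)) :=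
        Finset.prod_nonneg fun i _ => mul_nonneg (Real.rpow_nonneg (hw i).le _) (Real.exp_pos _).le
      simp only [Pi.zero_apply]
      positivity
    · exact Measurable.aestronglyMeasurable (by fun_prop)
  have hprod : ∫ w in {w : ι → ℝ | ∀ i, 0 < w i},
      (∏ i, w i ^ (2 * a / p - 1) * Real.exp (-c i * w i ^ (2 : ℝ))) =
      ∏ i, (c i ^ (-a / p) * (1 / 2) * Real.Gamma (a / p)) := by
    have hset : {w : ι → ℝ | ∀ i, 0 < w i} = Set.univ.pi fun _ => Set.Ioi 0 := by
      ext w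
      simp
    rw [hset, volume_pi, Measure.restrict_pi_pi, integral_fintype_prod_eq_prod
      (f := fun i x => x ^ (2 * a / p - 1) * Real.exp (-c i * x ^ (2 : ℝ)))]
    refine Finset.prod_congr rfl fun i _ => ?_
    have hap : 0 < 2 * a / p := by positivity
    rw [integral_rpow_mul_exp_neg_mul_rpow two_pos (by linarith) (hc i), sub_add_cancel,
      show -(2 * a / p) / 2 = -a / p by ring, show 2 * a / p / 2 = a / p by ring]
  have htotal := hleft.trans ((congrArg ENNReal.toReal (lintegral_torus_gaussian_eq c d a)).trans
    hright)
  rw [integral_mul_const, integral_mul_const, hprod, Finset.prod_mul_distrib,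
    Finset.prod_mul_distrib, Finset.prod_const, Finset.prod_const, Finset.card_univ, one_div 2, inv_pow] at htotal
  rw [← mul_left_inj' (by positivity : 2⁻¹ * Real.Gamma (a / 2) ≠ 0), htotal]
  rw [show (Fintype.card ι : ℝ) + 1 = p / 2 by rw [hp_def]; ring]
  field_simp
  ring

/-- The key computation in the proof of the plectic Hecke formula (Theorem 3.4):
for `n ∈ (ℝ^×)^r` and `δ > 0`,
`∫_{U_ℝ} ‖un‖^{-(r+δ)} d^×u
  = 2^{1-r} Γ((r+δ)/(2r))^r / (r Γ((r+δ)/2)) · ∏ⱼ |nⱼ|^{-(r+δ)/r}`,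
where `‖un‖² = ∑ⱼ uⱼ² nⱼ²` and `d^×u = du₁⋯du_{r-1}/(u₁⋯u_{r-1})`. -/
theorem hecke_transform_diagonal (r : ℕ) (hr : 1 ≤ r) (n : Fin r → ℝ)
    (hn : ∀ j, n j ≠ 0) (δ : ℝ) (hδ : 0 < δ) :
    (∫ w in {w : Fin (r - 1) → ℝ | ∀ i, 0 < w i},
        (Real.sqrt (∑ j, (torusCoord r w j) ^ 2 * (n j) ^ 2)) ^ (-((r : ℝ) + δ)) *
          ∏ i, (w i)⁻¹) =
      (2 : ℝ) ^ ((1 : ℝ) - (r : ℝ)) * Real.Gamma (((r : ℝ) + δ) / (2 * r)) ^ r /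
          ((r : ℝ) * Real.Gamma (((r : ℝ) + δ) / 2)) *
        ∏ j, (|n j| ^ (((r : ℝ) + δ) / r))⁻¹ := by
  obtain ⟨m, rfl⟩ : ∃ m, r = m + 1 := ⟨r - 1, by omega⟩
  set a : ℝ := ((m + 1 : ℕ) : ℝ) + δ with ha_def
  have ha : 0 < a := by positivity
  have hsq : ∀ j, 0 < n j ^ 2 := fun j => by have := hn j; positivity
  have key := integral_torus_rpow (ι := Fin m) (c := fun i => n i.castSucc ^ 2)
    (d := n (Fin.last m) ^ 2) (fun i => hsq _) (hsq _) ha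
  have hn_rpow : ∀ j, (n j ^ 2) ^ (-a / (2 * ((m : ℝ) + 1))) =
      (|n j| ^ (a / ((m + 1 : ℕ) : ℝ)))⁻¹ := by
    intro j
    rw [← sq_abs, ← Real.rpow_two, ← Real.rpow_mul (abs_nonneg _), ← Real.rpow_neg (abs_nonneg _)]
    congr 1
    push_cast
    field_simp
  have htwo : (2 : ℝ) ^ ((1 : ℝ) - ((m + 1 : ℕ) : ℝ)) = (2 ^ m)⁻¹ := by
    rw [← Real.rpow_natCast, ← Real.rpow_neg two_pos.le]
    congr 1
    push_cast
    ring
  simp only [Fintype.card_fin, hn_rpow] at key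
  rw [Fin.prod_univ_castSucc, htwo]
  refine Eq.trans (integral_congr_ae (Filter.Eventually.of_forall fun w => ?_)) (key.trans ?_)
  · change Fin m → ℝ at w
    have hcast : ∀ i : Fin m, torusCoord (m + 1) w i.castSucc = w i := fun i => by
      simp [torusCoord]
    have hlast : torusCoord (m + 1) w (Fin.last m) = (∏ i, w i)⁻¹ := by
      simp [torusCoord]
    have hnonneg : 0 ≤ ∑ i : Fin m, w i ^ 2 * n i.castSucc ^ 2 +
        (∏ i, w i)⁻¹ ^ 2 * n (Fin.last m) ^ 2 := by positivity
    simp only [Fin.sum_univ_castSucc, hcast, hlast]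
    rw [Real.sqrt_eq_rpow, ← Real.rpow_mul hnonneg]
    congr 2
    ring
  · push_cast
    field_simp
end
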